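/- Let p ≥ 1 and let F and G be nonzero nonnegative linear combinations of pure diagrams of codimension p−1 such that e(F) = e(G), and such that for every 0 ≤ i ≤ p−1 the maximal shift max{ j : F i j ≠ 0 } is strictly smaller than the minimal shift min{ j : G i j ≠ 0 }. Then the function E : ℤ × ℤ → ℚ defined by E i j = F i j + G (i−1) j is a nonnegative linear combination of pure diagrams of codimension p. -/

import Mathlib

/-- The alternating-sign Laurent polynomial `S_D(t) = Σ_{i,j} (-1)^i D(i,j) t^j`
associated to a diagram `D : ℤ × ℤ → ℚ`. -/
noncomputable def SPoly (D : ℤ × ℤ → ℚ) : LaurentPolynomial ℚ :=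
  ∑ᶠ q : ℤ × ℤ, LaurentPolynomial.C ((-1 : ℚ) ^ q.1 * D q) * LaurentPolynomial.T q.2

/-- A diagram of codimension `p`. -/
structure IsDiagram (p : ℕ) (D : ℤ × ℤ → ℚ) : Prop where
  finite : (Function.support D).Finite
  zero_outside : ∀ i j : ℤ, i < 0 ∨ (p : ℤ) < i → D (i, j) = 0
  dvd : (1 - LaurentPolynomial.T 1) ^ p ∣ SPoly D

/-- A pure diagram of type `d` of codimension `p`. -/
structure IsPureDiagram (p : ℕ) (d : Fin (p + 1) → ℤ) (D : ℤ × ℤ → ℚ) : Prop where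
  diagram : IsDiagram p D
  strictMono : StrictMono d
  pure : ∀ (k : Fin (p + 1)) (j : ℤ), j ≠ d k → D (((k : ℕ) : ℤ), j) = 0

/-- `D` is a nonnegative linear combination of pure diagrams of codimension `p`
(each with nonnegative entries). -/
def IsNonnegCombPure (p : ℕ) (D : ℤ × ℤ → ℚ) : Prop :=
  ∃ (n : ℕ) (a : Fin n → ℚ) (P : Fin n → (ℤ × ℤ → ℚ)) (t : Fin n → (Fin (p + 1) → ℤ)),
    (∀ k, 0 ≤ a k) ∧ (∀ k, IsPureDiagram p (t k) (P k)) ∧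
    (∀ k q, 0 ≤ P k q) ∧ D = ∑ k, a k • P k

/-- The sequence `(d₀, j+1, j+2, …, j+p-1, dₚ)`. -/
def midType (p : ℕ) (d0 j dp : ℤ) : Fin (p + 1) → ℤ :=
  fun k => if (k : ℕ) = 0 then d0 else if (k : ℕ) = p then dp else j + ((k : ℕ) : ℤ)

/-- An extremely compressed diagram of codimension `p`: a pure diagram of type
`(d₀, j+1, …, j+p-1, c+p)` for some `d₀ ≤ j ≤ c`. -/
def IsECDiagram (p : ℕ) (D : ℤ × ℤ → ℚ) : Prop :=
  ∃ d0 j c : ℤ, d0 ≤ j ∧ j ≤ c ∧ IsPureDiagram p (midType p d0 j (c + (p : ℤ))) D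

/-- `D` is a nonnegative linear combination of extremely compressed diagrams. -/
def IsNonnegCombEC (p : ℕ) (D : ℤ × ℤ → ℚ) : Prop :=
  ∃ (n : ℕ) (a : Fin n → ℚ) (P : Fin n → (ℤ × ℤ → ℚ)),
    (∀ k, 0 ≤ a k) ∧ (∀ k, IsECDiagram p (P k)) ∧ (∀ k q, 0 ≤ P k q) ∧ D = ∑ k, a k • P k

/-- The consecutive-cancellation diagram `C^{k,l}`. -/
def Ccan (k l : ℤ) : ℤ × ℤ → ℚ := fun q => if q = (k, l) ∨ q = (k + 1, l) then 1 else 0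

/-- `D` is obtained from `E` by a sequence of consecutive cancellations. -/
def ObtainedByCancel (E D : ℤ × ℤ → ℚ) : Prop :=
  ∃ b : ℤ × ℤ → ℚ, (Function.support b).Finite ∧ (∀ q, 0 ≤ b q) ∧ (∀ q, 0 ≤ D q) ∧
    ∀ q, D q = E q - ∑ᶠ r : ℤ × ℤ, b r * Ccan r.1 r.2 q

/-- The Laurent polynomial `Σ_j h_j t^j` of a coefficient function `h : ℤ → ℚ`. -/
noncomputable def rowPoly (h : ℤ → ℚ) : LaurentPolynomial ℚ :=
  ∑ᶠ j : ℤ, LaurentPolynomial.C (h j) * LaurentPolynomial.T j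

/-- `r_i = binom(p-1+i, p-1)` for `i ≥ 0`, and `0` for `i < 0`. -/
def rr (p : ℕ) (i : ℤ) : ℚ :=
  if i < 0 then 0 else (Nat.choose (p - 1 + i.toNat) (p - 1) : ℚ)

/-- Coefficients of the normalized `h`-vector of the extremely compressed diagram
of type `(0, j+1, …, j+p-1, c+p)`. -/
def hpi (p c j : ℕ) (i : ℤ) : ℚ :=
  if 0 ≤ i ∧ i ≤ (j : ℤ) then rr p i
  else if (j : ℤ) < i ∧ i ≤ (c : ℤ) then rr p (j : ℤ) / rr p ((c : ℤ) - (j : ℤ)) * rr p ((c : ℤ) - i)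
  else 0


open LaurentPolynomial in
/-- weighted coefficient sum -/
noncomputable def Lf (φ : ℤ → ℚ) : LaurentPolynomial ℚ →+ ℚ where
  toFun f := f.coeff.sum fun j c => c * φ j
  map_zero' := by simp
  map_add' f g := by
    rw [AddMonoidAlgebra.coeff_add, Finsupp.sum_add_index'] <;> intros <;> ring

open LaurentPolynomial in
lemma Lf_CT (φ : ℤ → ℚ) (a : ℚ) (j : ℤ) :
    Lf φ (LaurentPolynomial.C a * LaurentPolynomial.T j) = a * φ j := by
  rw [← LaurentPolynomial.single_eq_C_mul_T]
  show (AddMonoidAlgebra.single j a : LaurentPolynomial ℚ).coeff.sum (fun j c => c * φ j) = _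
  rw [AddMonoidAlgebra.coeff_single]
  exact Finsupp.sum_single_index (by simp)

lemma Lf_one_sub_mul (φ : ℤ → ℚ) (h : LaurentPolynomial ℚ) :
    Lf φ ((1 - LaurentPolynomial.T 1) * h) = - Lf (fwdDiff 1 φ) h := by
  induction h using LaurentPolynomial.induction_on' with
  | add f g hf hg => rw [mul_add, map_add, map_add, hf, hg]; ring
  | C_mul_T n a =>
    have : (1 - LaurentPolynomial.T 1) * (LaurentPolynomial.C a * LaurentPolynomial.T n)
      = LaurentPolynomial.C a * LaurentPolynomial.T n
        - LaurentPolynomial.C a * LaurentPolynomial.T (n + 1) := by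
      rw [LaurentPolynomial.T_add]; ring
    rw [this, map_sub, Lf_CT, Lf_CT, Lf_CT, fwdDiff]; ring

lemma Lf_pow_mul (n : ℕ) (φ : ℤ → ℚ) (h : LaurentPolynomial ℚ) :
    Lf φ ((1 - LaurentPolynomial.T 1) ^ n * h) = (-1) ^ n * Lf ((fwdDiff 1)^[n] φ) h := by
  induction n generalizing φ with
  | zero => simp
  | succ n ih =>
    rw [pow_succ', mul_assoc, Lf_one_sub_mul, ih, Function.iterate_succ_apply]; ring

lemma fwdDiff_cast (n : ℕ) (f : ℚ → ℚ) :
    (fwdDiff 1)^[n] (fun j : ℤ => f j) = fun j : ℤ => ((fwdDiff 1)^[n] f) j := by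
  induction n generalizing f with
  | zero => rfl
  | succ n ih =>
    rw [Function.iterate_succ_apply, Function.iterate_succ_apply, ← ih]
    congr 1
    funext j
    simp [fwdDiff]

/-- evaluation function of a polynomial -/
noncomputable def pe (q : Polynomial ℚ) : ℤ → ℚ := fun j => q.eval (j : ℚ)

lemma Lf_monic {n : ℕ} {q : Polynomial ℚ} (hq : q.Monic) (hn : q.natDegree = n)
    (h : LaurentPolynomial ℚ) :
    Lf (pe q) ((1 - LaurentPolynomial.T 1) ^ n * h)
      = (-1) ^ n * (n.factorial * Lf (fun _ => 1) h) := by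
  rw [Lf_pow_mul]
  congr 1
  have := fwdDiff_cast n q.eval
  rw [show pe q = fun j : ℤ => q.eval (j : ℚ) from rfl, this]
  have h2 := Polynomial.fwdDiff_iter_degree_eq_factorial q
  rw [hn, hq.leadingCoeff] at h2
  rw [h2]
  induction h using LaurentPolynomial.induction_on' with
  | add f g hf hg => rw [map_add, map_add, hf, hg]; ring
  | C_mul_T n a => rw [Lf_CT, Lf_CT]; simp; ring

lemma fwdDiff_desc (m : ℕ) : fwdDiff 1 (pe (descPochhammer ℚ (m + 1)))
    = fun j => ((m : ℚ) + 1) * pe (descPochhammer ℚ m) j := by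
  funext j
  have := congrArg (Polynomial.eval ((j : ℚ) + 1)) (descPochhammer_succ_comp_X_sub_one ℚ m)
  simp [Polynomial.eval_comp] at this
  simp only [fwdDiff, pe]
  push_cast
  rw [this]; ring

lemma Lf_const_mul (c : ℚ) (φ : ℤ → ℚ) (h : LaurentPolynomial ℚ) :
    Lf (fun j => c * φ j) h = c * Lf φ h := by
  induction h using LaurentPolynomial.induction_on' with
  | add f g hf hg => rw [map_add, map_add, hf, hg]; ring
  | C_mul_T n a => rw [Lf_CT, Lf_CT]; ring

lemma dvd_T_sub (j : ℤ) : (1 - LaurentPolynomial.T 1 : LaurentPolynomial ℚ) ∣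
    LaurentPolynomial.T j - 1 := by
  induction j using Int.induction_on with
  | zero => simp
  | succ i ih =>
    have : (LaurentPolynomial.T ((i : ℤ) + 1) - 1 : LaurentPolynomial ℚ)
      = LaurentPolynomial.T 1 * (LaurentPolynomial.T i - 1) - (1 - LaurentPolynomial.T 1) := by
      rw [LaurentPolynomial.T_add]; ring
    rw [this]
    exact dvd_sub (ih.mul_left _) dvd_rfl
  | pred i ih =>
    have : (LaurentPolynomial.T (-(i : ℤ) - 1) - 1 : LaurentPolynomial ℚ)
      = LaurentPolynomial.T (-1) * (LaurentPolynomial.T (-i) - 1)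
        + LaurentPolynomial.T (-1) * (1 - LaurentPolynomial.T 1) := by
      rw [LaurentPolynomial.T_sub, mul_sub, mul_sub, ← LaurentPolynomial.T_add,
        ← LaurentPolynomial.T_add, ← LaurentPolynomial.T_add]
      simp [add_comm]
    rw [this]
    exact dvd_add (ih.mul_left _) (dvd_mul_left _ _)

lemma dvd_sub_C (S : LaurentPolynomial ℚ) : (1 - LaurentPolynomial.T 1 : LaurentPolynomial ℚ) ∣
    S - LaurentPolynomial.C (Lf (fun _ => 1) S) := by
  induction S using LaurentPolynomial.induction_on' with
  | add f g hf hg =>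
    rw [map_add, map_add]
    convert dvd_add hf hg using 1
    ring
  | C_mul_T n a =>
    rw [Lf_CT, mul_one]
    have := (dvd_T_sub n).mul_left (LaurentPolynomial.C a)
    rwa [mul_sub, mul_one] at this

lemma dvd_of_moments (n : ℕ) (S : LaurentPolynomial ℚ)
    (h : ∀ m < n, Lf (pe (descPochhammer ℚ m)) S = 0) :
    (1 - LaurentPolynomial.T 1) ^ n ∣ S := by
  induction n generalizing S with
  | zero => simp
  | succ n ih =>
    have h0 := h 0 (by omega)
    have h1 : pe (descPochhammer ℚ 0) = fun _ => 1 := by funext j; simp [pe]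
    rw [h1] at h0
    have h2 := dvd_sub_C S
    rw [h0, map_zero, sub_zero] at h2
    obtain ⟨R, rfl⟩ := h2
    rw [pow_succ']
    apply mul_dvd_mul_left
    apply ih
    intro m hm
    have := h (m + 1) (by omega)
    rw [Lf_one_sub_mul, fwdDiff_desc, Lf_const_mul] at this
    have h3 : (m : ℚ) + 1 ≠ 0 := by positivity
    simpa [h3] using this

/-- the pure weights -/
def wt (s : Finset ℕ) (x : ℕ → ℤ) (i : ℕ) : ℚ :=
  ∏ m ∈ s.erase i, |(x i : ℚ) - x m|⁻¹

/-- standard pure diagram -/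
def stdD (n : ℕ) (x : ℕ → ℤ) : ℤ × ℤ → ℚ := fun q =>
  if 0 ≤ q.1 ∧ q.1 ≤ n ∧ q.2 = x q.1.toNat then wt (Finset.range (n + 1)) x q.1.toNat else 0

lemma wt_nonneg (s : Finset ℕ) (x : ℕ → ℤ) (i : ℕ) : 0 ≤ wt s x i :=
  Finset.prod_nonneg fun _ _ => by positivity

lemma SPoly_eq_sum (D : ℤ × ℤ → ℚ) (s : Finset (ℤ × ℤ)) (h : ∀ q, D q ≠ 0 → q ∈ s) :
    SPoly D = ∑ q ∈ s, LaurentPolynomial.C ((-1 : ℚ) ^ q.1 * D q) * LaurentPolynomial.T q.2 := by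
  apply finsum_eq_sum_of_support_subset
  intro q hq
  apply h
  intro h0
  simp [h0] at hq

lemma Lf_SPoly_pure {n : ℕ} {x : ℕ → ℤ} {D : ℤ × ℤ → ℚ}
    (h : ∀ q, D q ≠ 0 → ∃ k : ℕ, k ≤ n ∧ q = ((k : ℤ), x k)) (φ : ℤ → ℚ) :
    Lf φ (SPoly D) = ∑ k ∈ Finset.range (n + 1), (-1) ^ k * D ((k : ℤ), x k) * φ (x k) := by
  rw [SPoly_eq_sum D ((Finset.range (n + 1)).image fun k : ℕ => ((k : ℤ), x k)), map_sum,
    Finset.sum_image]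
  · simp only [Lf_CT, zpow_natCast]
  · intro a _ b _ hab
    simpa using (Prod.ext_iff.1 hab).1
  · intro q hq
    obtain ⟨k, hk, rfl⟩ := h q hq
    exact Finset.mem_image.2 ⟨k, by simp; omega, rfl⟩

lemma sgn_prod {n : ℕ} {x : ℕ → ℤ} (hx : ∀ a b, a < b → b ≤ n → x a < x b) {i : ℕ} (hi : i ≤ n) :
    (-1 : ℚ) ^ n * (-1) ^ i * ∏ m ∈ (Finset.range (n + 1)).erase i, ((x i : ℚ) - x m)
      = ∏ m ∈ (Finset.range (n + 1)).erase i, |(x i : ℚ) - x m| := by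
  have h1 : ∀ m ∈ (Finset.range (n + 1)).erase i, ((x i : ℚ) - x m)
      = (if i < m then -1 else 1) * |(x i : ℚ) - x m| := by
    intro m hm
    simp at hm
    split_ifs with h
    · have : (x i : ℚ) < x m := by exact_mod_cast hx i m h (by omega)
      rw [abs_of_neg (by linarith)]; ring
    · have : (x m : ℚ) < x i := by exact_mod_cast hx m i (by omega) hi
      rw [abs_of_pos (by linarith)]; ring
  rw [Finset.prod_congr rfl h1, Finset.prod_mul_distrib, Finset.prod_ite]
  have h2 : ((Finset.range (n + 1)).erase i).filter (fun m => i < m) = Finset.Ioc i n := by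
    ext m; simp; omega
  rw [h2]
  simp only [Finset.prod_const, Nat.card_Ioc, one_pow, mul_one]
  rw [← mul_assoc, ← pow_add, ← pow_add, show n + i + (n - i) = 2 * n by omega, pow_mul]
  simp

lemma stdD_supp {n : ℕ} {x : ℕ → ℤ} (q : ℤ × ℤ) (h : stdD n x q ≠ 0) :
    ∃ k : ℕ, k ≤ n ∧ q = ((k : ℤ), x k) := by
  unfold stdD at h
  split_ifs at h with h1
  · refine ⟨q.1.toNat, by omega, ?_⟩
    ext
    · simp; omega
    · exact h1.2.2
  · exact absurd rfl h

lemma stdD_self {n : ℕ} {x : ℕ → ℤ} {k : ℕ} (hk : k ≤ n) :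
    stdD n x ((k : ℤ), x k) = wt (Finset.range (n + 1)) x k := by
  simp [stdD, hk]

lemma stdD_pure {n : ℕ} {x : ℕ → ℤ} (hx : ∀ a b, a < b → b ≤ n → x a < x b) :
    IsPureDiagram n (fun k => x k) (stdD n x) where
  diagram :=
    { finite := by
        apply Set.Finite.subset ((Finset.range (n + 1)).image fun k : ℕ => ((k : ℤ), x k)).finite_toSet
        intro q hq
        obtain ⟨k, hk, rfl⟩ := stdD_supp q hq
        simp only [Finset.coe_image, Set.mem_image]
        exact ⟨k, by simp; omega, rfl⟩
      zero_outside := by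
        intro i j h
        by_contra hc
        obtain ⟨k, hk, hq⟩ := stdD_supp _ hc
        simp at hq
        omega
      dvd := by
        apply dvd_of_moments
        intro m hm
        rw [Lf_SPoly_pure stdD_supp]
        have hinj : Set.InjOn (fun k => (x k : ℚ)) (Finset.range (n + 1)) := by
          intro a ha b hb hab
          simp at ha hb hab
          rcases lt_trichotomy a b with h | h | h
          · have := hx a b h (by omega); omega
          · exact h
          · have := hx b a h (by omega); omega
        have hdeg : (descPochhammer ℚ m).natDegree = m := descPochhammer_natDegree ℚ m
        have hmon : (descPochhammer ℚ m).Monic := monic_descPochhammer ℚ m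
        have h1 := Lagrange.coeff_eq_sum hinj (P := descPochhammer ℚ m) (by
          rw [Polynomial.degree_eq_natDegree hmon.ne_zero, hdeg, Finset.card_range]; exact_mod_cast (by omega : m < n + 1))
        rw [Polynomial.coeff_eq_zero_of_natDegree_lt (by rw [hdeg]; simpa using hm)] at h1
        have h2 : ∑ k ∈ Finset.range (n + 1), (-1) ^ k * stdD n x ((k : ℤ), x k)
            * pe (descPochhammer ℚ m) (x k) = (-1) ^ n * 0 := by
          rw [h1, Finset.mul_sum]
          apply Finset.sum_congr rfl
          intro k hk
          have hk' : k ≤ n := by simp at hk; omega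
          rw [stdD_self hk', wt, Finset.prod_inv_distrib, ← sgn_prod hx hk', mul_inv, mul_inv, pe,
            div_eq_mul_inv, ← inv_pow, ← inv_pow]
          have h3 : ((-1 : ℚ) ^ k * (-1) ^ k) = 1 := by
            rw [← mul_pow]; simp
          have h4 : (-1 : ℚ)⁻¹ = -1 := by norm_num
          rw [h4]
          linear_combination ((-1 : ℚ) ^ n * (∏ m ∈ (Finset.range (n + 1)).erase k, ((x k : ℚ) - x m))⁻¹
            * Polynomial.eval (x k : ℚ) (descPochhammer ℚ m)) * h3
        rw [h2, mul_zero] }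
  strictMono := by
    intro a b hab
    exact hx a b hab (by omega)
  pure := by
    intro k j hj
    by_contra hc
    obtain ⟨k', hk, hq⟩ := stdD_supp _ hc
    simp at hq
    rw [hq.1] at hj
    exact hj hq.2

lemma stdD_nonneg (n : ℕ) (x : ℕ → ℤ) (q : ℤ × ℤ) : 0 ≤ stdD n x q := by
  unfold stdD
  split_ifs
  · exact wt_nonneg _ _ _
  · exact le_rfl

/-- extend a finite sequence -/
def extSeq (n : ℕ) (t : Fin (n + 1) → ℤ) : ℕ → ℤ := fun m => if h : m < n + 1 then t ⟨m, h⟩ else 0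

lemma ext_mono {n : ℕ} {t : Fin (n + 1) → ℤ} (ht : StrictMono t) :
    ∀ a b, a < b → b ≤ n → extSeq n t a < extSeq n t b := by
  intro a b hab hb
  simp only [extSeq, show a < n + 1 by omega, show b < n + 1 by omega, dif_pos]
  exact ht (by simpa using hab)

lemma pure_eq {n : ℕ} {t : Fin (n + 1) → ℤ} {P : ℤ × ℤ → ℚ} (hP : IsPureDiagram n t P) :
    P = ((-1) ^ n * Lf (pe (Polynomial.X ^ n)) (SPoly P)) • stdD n (extSeq n t) := by
  set x := extSeq n t with hxdef
  have hx := ext_mono hP.strictMono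
  rw [← hxdef] at hx
  have hsupp : ∀ q, P q ≠ 0 → ∃ k : ℕ, k ≤ n ∧ q = ((k : ℤ), x k) := by
    rintro ⟨i, j⟩ hq
    have h1 : ¬ (i < 0 ∨ (n : ℤ) < i) := fun h => hq (hP.diagram.zero_outside i j h)
    push Not at h1
    lift i to ℕ using h1.1
    have hi : i ≤ n := by omega
    refine ⟨i, hi, ?_⟩
    by_contra hc
    apply hq
    apply hP.pure ⟨i, by omega⟩ j
    intro hj
    apply hc
    rw [hj, hxdef, extSeq, dif_pos]
  obtain ⟨h, hh⟩ := hP.diagram.dvd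
  funext q
  rw [Pi.smul_apply, smul_eq_mul]
  by_cases hq : ∃ k : ℕ, k ≤ n ∧ q = ((k : ℤ), x k)
  · obtain ⟨k, hk, rfl⟩ := hq
    rw [stdD_self hk]
    set Q : Polynomial ℚ := ∏ m ∈ (Finset.range (n + 1)).erase k,
      (Polynomial.X - Polynomial.C (x m : ℚ)) with hQ
    have hQm : Q.Monic := Polynomial.monic_prod_X_sub_C _ _
    have hQd : Q.natDegree = n := by
      rw [hQ, Polynomial.natDegree_finsetProd_X_sub_C_eq_card, Finset.card_erase_of_mem] <;> simp
      omega
    have e1 := Lf_monic hQm hQd h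
    have e2 := Lf_monic (Polynomial.monic_X_pow n) (Polynomial.natDegree_X_pow n) h
    rw [← e2, ← hh, Lf_SPoly_pure hsupp, Finset.sum_eq_single k] at e1
    · rw [← e1]
      have h5 : pe Q (x k) = ∏ m ∈ (Finset.range (n + 1)).erase k, ((x k : ℚ) - x m) := by
        simp [pe, hQ, Polynomial.eval_prod]
      rw [h5]
      have h6 := sgn_prod hx hk
      have h7 : ∏ m ∈ (Finset.range (n + 1)).erase k, |(x k : ℚ) - x m| ≠ 0 := by
        rw [Finset.prod_ne_zero_iff]
        intro m hm
        simp at hm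
        rw [abs_ne_zero, sub_ne_zero]
        norm_cast
        rcases lt_or_gt_of_ne hm.1 with h | h
        · exact (hx m k h hk).ne'
        · exact (hx k m h (by omega)).ne
      rw [wt, Finset.prod_inv_distrib]
      field_simp
      rw [← h6]
      ring
    · intro m hm hmk
      have : pe Q (x m) = 0 := by
        simp only [pe, hQ, Polynomial.eval_prod]
        apply Finset.prod_eq_zero (i := m)
        · simp at hm ⊢; omega
        · simp
      rw [this, mul_zero]
    · intro hc
      simp at hc; omega
  · have h1 : P q = 0 := by
      by_contra hc; exact hq (hsupp q hc)
    have h2 : stdD n x q = 0 := by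
      by_contra hc; exact hq (stdD_supp q hc)
    rw [h1, h2, mul_zero]

lemma comb_zero (p : ℕ) : IsNonnegCombPure p 0 :=
  ⟨0, Fin.elim0, Fin.elim0, Fin.elim0, fun k => k.elim0, fun k => k.elim0, fun k => k.elim0, by simp⟩

lemma comb_add {p : ℕ} {D E : ℤ × ℤ → ℚ} (hD : IsNonnegCombPure p D) (hE : IsNonnegCombPure p E) :
    IsNonnegCombPure p (D + E) := by
  obtain ⟨n, a, P, t, h1, h2, h3, h4⟩ := hD
  obtain ⟨m, b, Q, u, k1, k2, k3, k4⟩ := hE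
  refine ⟨n + m, Fin.append a b, Fin.append P Q, Fin.append t u, ?_, ?_, ?_, ?_⟩
  · intro k; refine Fin.addCases (fun i => ?_) (fun i => ?_) k
    · simpa using h1 i
    · simpa using k1 i
  · intro k; refine Fin.addCases (fun i => ?_) (fun i => ?_) k
    · simpa using h2 i
    · simpa using k2 i
  · intro k; refine Fin.addCases (fun i => ?_) (fun i => ?_) k
    · simpa using h3 i
    · simpa using k3 i
  · rw [Fin.sum_univ_add, h4, k4]; simp

lemma comb_smul {p : ℕ} {D : ℤ × ℤ → ℚ} {c : ℚ} (hc : 0 ≤ c) (hD : IsNonnegCombPure p D) :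
    IsNonnegCombPure p (c • D) := by
  obtain ⟨n, a, P, t, h1, h2, h3, h4⟩ := hD
  refine ⟨n, fun k => c * a k, P, t, fun k => mul_nonneg hc (h1 k), h2, h3, ?_⟩
  rw [h4, Finset.smul_sum]
  simp [mul_smul]

lemma comb_sum {p : ℕ} {ι : Type*} (s : Finset ι) {D : ι → ℤ × ℤ → ℚ}
    (hD : ∀ i ∈ s, IsNonnegCombPure p (D i)) :
    IsNonnegCombPure p (∑ i ∈ s, D i) :=
  Finset.sum_induction _ _ (fun _ _ => comb_add) (comb_zero p) hD

lemma comb_std {p : ℕ} {x : ℕ → ℤ} (hx : ∀ a b, a < b → b ≤ p → x a < x b) :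
    IsNonnegCombPure p (stdD p x) :=
  ⟨1, fun _ => 1, fun _ => stdD p x, fun _ => fun k => x k, by simp, fun _ => stdD_pure hx,
    fun _ => stdD_nonneg _ _, by simp⟩

/-- mixed sequence -/
def mix (f g : ℕ → ℤ) (k : ℕ) : ℕ → ℤ := fun m => if m ≤ k then f m else g (m - 1)

/-- intermediate signed diagrams -/
def tau (n : ℕ) (f g : ℕ → ℤ) (k : ℕ) : ℤ × ℤ → ℚ := fun q =>
  if 0 ≤ q.1 ∧ q.1 ≤ (n : ℤ) + 1 ∧ q.1.toNat ≠ k ∧ q.2 = mix f g k q.1.toNat then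
    (if q.1.toNat < k then 1 else -1) * wt ((Finset.range (n + 2)).erase k) (mix f g k) q.1.toNat
  else 0

lemma wt_congr (s : Finset ℕ) {x y : ℕ → ℤ} {i : ℕ} (hi : x i = y i) (h : ∀ m ∈ s, x m = y m) :
    wt s x i = wt s y i := by
  unfold wt
  apply Finset.prod_congr rfl
  intro m hm
  rw [hi, h m (Finset.mem_of_mem_erase hm)]

lemma wt_erase {s : Finset ℕ} {x : ℕ → ℤ} {i k : ℕ} (hk : k ∈ s) (hik : k ≠ i) :
    wt s x i = wt (s.erase k) x i * |(x i : ℚ) - x k|⁻¹ := by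
  unfold wt
  rw [Finset.erase_right_comm, mul_comm]
  exact (Finset.mul_prod_erase _ (fun m => |(x i : ℚ) - x m|⁻¹)
    (Finset.mem_erase.2 ⟨hik, hk⟩)).symm

lemma wt_self (s : Finset ℕ) (x : ℕ → ℤ) (k : ℕ) : wt (s.erase k) x k = wt s x k := by
  unfold wt; rw [Finset.erase_idem]

lemma tau_step {n : ℕ} {f g : ℕ → ℤ} {k : ℕ} (hk : k ≤ n)
    (hx : ∀ a b, a < b → b ≤ n + 1 → mix f g k a < mix f g k b) (q : ℤ × ℤ) :
    tau n f g (k + 1) q - tau n f g k q = ((g k : ℚ) - f k) * stdD (n + 1) (mix f g k) q := by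
  obtain ⟨i, j⟩ := q
  by_cases hi : 0 ≤ i ∧ i ≤ (n : ℤ) + 1
  swap
  · have h1 : ∀ k, tau n f g k (i, j) = 0 := by
      intro k
      simp only [tau]
      rw [if_neg]; tauto
    have h2 : stdD (n + 1) (mix f g k) (i, j) = 0 := by
      simp only [stdD]
      rw [if_neg]; push_cast; tauto
    rw [h1, h1, h2]; simp
  obtain ⟨h0, h1⟩ := hi
  lift i to ℕ using h0
  have hin : i ≤ n + 1 := by omega
  have hmix : ∀ m, m ≠ k + 1 → mix f g (k + 1) m = mix f g k m := by
    intro m hm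
    unfold mix
    by_cases h : m ≤ k
    · rw [if_pos h, if_pos (by omega)]
    · rw [if_neg h, if_neg (by omega)]
  have hw : i ≠ k + 1 → wt ((Finset.range (n + 2)).erase (k + 1)) (mix f g (k + 1)) i
      = wt ((Finset.range (n + 2)).erase (k + 1)) (mix f g k) i := by
    intro h
    apply wt_congr _ (hmix i h)
    intro m hm
    exact hmix m (Finset.ne_of_mem_erase hm)
  set x := mix f g k with hxd
  have hxk : x k = f k := by simp [hxd, mix]
  have hxk1 : x (k + 1) = g k := by simp [hxd, mix]
  have hlt : (x k : ℚ) < x (k + 1) := by exact_mod_cast hx k (k + 1) (by omega) (by omega)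
  rw [← hxk, ← hxk1]
  have hkm : k ∈ Finset.range (n + 2) := by simp; omega
  have hkm1 : k + 1 ∈ Finset.range (n + 2) := by simp; omega
  simp only [tau, stdD, Int.toNat_natCast, Nat.cast_nonneg, true_and]
  rw [← hxd]
  push_cast
  simp only [h1, true_and]
  by_cases hik : i = k
  · subst hik
    rw [hmix i (by omega), hw (by omega)]
    by_cases hj : j = x i
    · rw [if_pos (show i ≠ i + 1 ∧ j = x i from ⟨by omega, hj⟩),
        if_neg (show ¬ (i ≠ i ∧ j = x i) by simp), if_pos hj, if_pos (show i < i + 1 by omega),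
        wt_erase (s := Finset.range (n + 1 + 1)) hkm1 (by omega), abs_sub_comm,
        abs_of_pos (by linarith)]
      have : ((x (i + 1) : ℚ) - x i) ≠ 0 := by linarith
      field_simp
      ring
    · simp [hj]
  by_cases hik1 : i = k + 1
  · subst hik1
    by_cases hj : j = x (k + 1)
    · rw [if_neg (by simp), if_pos (show k + 1 ≠ k ∧ j = x (k + 1) from ⟨by omega, hj⟩), if_pos hj,
        if_neg (show ¬ (k + 1 < k) by omega),
        wt_erase (s := Finset.range (n + 1 + 1)) hkm (by omega), abs_of_pos (by linarith)]
      have : ((x (k + 1) : ℚ) - x k) ≠ 0 := by linarith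
      field_simp
      ring
    · simp [hj]
  rw [hmix i hik1, hw hik1]
  by_cases hj : j = x i
  swap
  · simp [hj]
  rw [if_pos (show i ≠ k + 1 ∧ j = x i from ⟨hik1, hj⟩),
    if_pos (show i ≠ k ∧ j = x i from ⟨hik, hj⟩), if_pos hj]
  have hkm' : k ∈ (Finset.range (n + 2)).erase (k + 1) := by simp; omega
  have hkm1' : k + 1 ∈ (Finset.range (n + 2)).erase k := by simp; omega
  have hR : ((Finset.range (n + 2)).erase (k + 1)).erase k
    = ((Finset.range (n + 2)).erase k).erase (k + 1) := Finset.erase_right_comm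
  rw [wt_erase (s := Finset.range (n + 1 + 1)) hkm (Ne.symm hik), wt_erase hkm1' (Ne.symm hik1),
    wt_erase hkm' (Ne.symm hik), hR]
  rcases lt_or_gt_of_ne hik with h | h
  · have h3 : (x i : ℚ) < x k := by exact_mod_cast hx i k h (by omega)
    rw [if_pos h, if_pos (show i < k + 1 by omega), abs_sub_comm, abs_sub_comm (x i : ℚ),
      abs_of_pos (by linarith), abs_of_pos (by linarith)]
    have e1 : ((x k : ℚ) - x i) ≠ 0 := by linarith
    have e2 : ((x (k + 1) : ℚ) - x i) ≠ 0 := by linarith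
    field_simp
    ring
  · have h3 : (x (k + 1) : ℚ) < x i := by exact_mod_cast hx (k + 1) i (by omega) (by omega)
    rw [if_neg (show ¬ (i < k + 1) by omega), if_neg (show ¬ (i < k) by omega), abs_of_pos (by linarith), abs_of_pos (by linarith)]
    have e1 : ((x i : ℚ) - x k) ≠ 0 := by linarith
    have e2 : ((x i : ℚ) - x (k + 1)) ≠ 0 := by linarith
    field_simp
    ring

lemma tau_last (n : ℕ) (f g : ℕ → ℤ) : tau n f g (n + 1) = stdD n f := by
  funext ⟨i, j⟩
  simp only [tau, stdD]
  by_cases h : 0 ≤ i ∧ i ≤ (n : ℤ)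
  · obtain ⟨h0, h1⟩ := h
    lift i to ℕ using h0
    have hm : ∀ m, m ≤ n → mix f g (n + 1) m = f m := by
      intro m hm; rw [mix, if_pos (by omega)]
    have hi : i ≤ n := by omega
    have hs : (Finset.range (n + 2)).erase (n + 1) = Finset.range (n + 1) := by
      ext m; simp; omega
    rw [Int.toNat_natCast, hm i hi, hs, if_pos (show i < n + 1 by omega), one_mul,
      wt_congr _ (hm i hi) (fun m h => hm m (by simp at h; omega))]
    congr 1
    apply propext
    constructor
    · rintro ⟨a, b, c, d⟩; exact ⟨a, h1, d⟩
    · rintro ⟨a, b, d⟩; exact ⟨a, by omega, by omega, d⟩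
  · rw [if_neg, if_neg]
    · tauto
    · rintro ⟨a, b, c, d⟩; apply h; omega

lemma tau_zero (n : ℕ) (f g : ℕ → ℤ) (q : ℤ × ℤ) :
    tau n f g 0 q = - stdD n g (q.1 - 1, q.2) := by
  obtain ⟨i, j⟩ := q
  simp only [tau, stdD]
  by_cases h : 1 ≤ i ∧ i ≤ (n : ℤ) + 1
  · obtain ⟨h0, h1⟩ := h
    obtain ⟨m, rfl⟩ : ∃ m : ℕ, i = (m : ℤ) + 1 := ⟨(i - 1).toNat, by omega⟩
    have e1 : ((m : ℤ) + 1).toNat = m + 1 := by omega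
    have e2 : ((m : ℤ) + 1 - 1).toNat = m := by omega
    rw [e1, e2]
    have hmx : ∀ m, mix f g 0 (m + 1) = g m := by intro m; simp [mix]
    rw [hmx, if_neg (show ¬ (m + 1 < 0) by omega)]
    have hw : wt ((Finset.range (n + 2)).erase 0) (mix f g 0) (m + 1)
        = wt (Finset.range (n + 1)) g m := by
      unfold wt
      have hs : ((Finset.range (n + 2)).erase 0).erase (m + 1)
          = ((Finset.range (n + 1)).erase m).image Nat.succ := by
        ext a
        cases a with
        | zero => simp
        | succ a => simp
      rw [hs, Finset.prod_image (by intro a _ b _ h; simpa using h)]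
      apply Finset.prod_congr rfl
      intro a _
      rw [Nat.succ_eq_add_one, hmx, hmx]
    rw [hw]
    by_cases hj : j = g m
    · rw [if_pos ⟨by omega, h1, by omega, hj⟩, if_pos ⟨by omega, by omega, hj⟩]; ring
    · rw [if_neg (by tauto), if_neg (by tauto)]; simp
  · rw [if_neg, if_neg]
    · simp
    · rintro ⟨a, b, d⟩; apply h; omega
    · rintro ⟨a, b, c, d⟩; apply h; omega

lemma comb_pair {n : ℕ} {f g : ℕ → ℤ} (hf : ∀ a b, a < b → b ≤ n → f a < f b)
    (hg : ∀ a b, a < b → b ≤ n → g a < g b) (hfg : ∀ a, a ≤ n → f a < g a) :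
    IsNonnegCombPure (n + 1) (fun q => stdD n f q + stdD n g (q.1 - 1, q.2)) := by
  have hx : ∀ k ≤ n, ∀ a b, a < b → b ≤ n + 1 → mix f g k a < mix f g k b := by
    intro k hk a b hab hb
    unfold mix
    split_ifs with h1 h2
    · exact hf a b hab (by omega)
    · rcases Nat.lt_or_ge a (b - 1) with h | h
      · exact (hfg a (by omega)).trans (hg a (b - 1) h (by omega))
      · have : b - 1 = a := by omega
        rw [this]; exact hfg a (by omega)
    · omega
    · exact hg (a - 1) (b - 1) (by omega) (by omega)
  have : (fun q => stdD n f q + stdD n g (q.1 - 1, q.2))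
      = ∑ k ∈ Finset.range (n + 1), ((g k : ℚ) - f k) • stdD (n + 1) (mix f g k) := by
    funext q
    have h1 := Finset.sum_range_sub (fun k => tau n f g k q) (n + 1)
    rw [tau_last, tau_zero, sub_neg_eq_add] at h1
    rw [← h1, Finset.sum_apply]
    apply Finset.sum_congr rfl
    intro k hk
    simp at hk
    rw [tau_step (by omega) (hx k (by omega))]
    rfl
  rw [this]
  apply comb_sum
  intro k hk
  simp at hk
  apply comb_smul
  · have : (f k : ℚ) < g k := by exact_mod_cast hfg k (by omega)
    linarith
  · exact comb_std (hx k (by omega))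

/-- the normalized multiplicity -/
noncomputable def mulN (n : ℕ) (D : ℤ × ℤ → ℚ) : ℚ :=
  (-1) ^ n * Lf (pe (Polynomial.X ^ n)) (SPoly D)

lemma mulN_of {n : ℕ} {D : ℤ × ℤ → ℚ} {e : ℤ → ℚ} (he : (Function.support e).Finite)
    (h : SPoly D = (1 - LaurentPolynomial.T 1) ^ n * rowPoly e) :
    mulN n D = n.factorial * ∑ᶠ i, e i := by
  rw [mulN, h, Lf_monic (Polynomial.monic_X_pow n) (Polynomial.natDegree_X_pow n),
    ← mul_assoc, ← mul_pow]
  have h2 : rowPoly e = ∑ j ∈ he.toFinset, LaurentPolynomial.C (e j) * LaurentPolynomial.T j := by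
    apply finsum_eq_sum_of_support_subset
    intro q hq
    simp only [Set.Finite.coe_toFinset]
    intro h0
    simp [h0] at hq
  have h3 : ∑ᶠ i, e i = ∑ j ∈ he.toFinset, e j :=
    finsum_eq_sum_of_support_subset _ (by simp)
  rw [h2, h3, map_sum]
  simp [Lf_CT]

lemma mulN_sum {n N : ℕ} (a : Fin N → ℚ) (P : Fin N → ℤ × ℤ → ℚ)
    (hP : ∀ k, (Function.support (P k)).Finite) :
    mulN n (∑ k, a k • P k) = ∑ k, a k * mulN n (P k) := by
  classical
  set s : Finset (ℤ × ℤ) := Finset.univ.biUnion fun k => (hP k).toFinset with hs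
  have h1 : ∀ k q, P k q ≠ 0 → q ∈ s := by
    intro k q hq
    rw [hs, Finset.mem_biUnion]
    exact ⟨k, Finset.mem_univ _, by simpa using hq⟩
  have h2 : ∀ q, (∑ k, a k • P k) q ≠ 0 → q ∈ s := by
    intro q hq
    by_contra hc
    apply hq
    rw [Finset.sum_apply]
    apply Finset.sum_eq_zero
    intro k _
    have : P k q = 0 := by
      by_contra h; exact hc (h1 k q h)
    simp [this]
  unfold mulN
  rw [SPoly_eq_sum _ s h2, map_sum, Finset.mul_sum]
  simp only [Lf_CT]
  have h3 : ∀ k, Lf (pe (Polynomial.X ^ n)) (SPoly (P k))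
      = ∑ q ∈ s, (-1 : ℚ) ^ q.1 * P k q * pe (Polynomial.X ^ n) q.2 := by
    intro k
    rw [SPoly_eq_sum _ s (h1 k), map_sum]
    simp only [Lf_CT]
  simp only [h3, Finset.mul_sum]
  rw [Finset.sum_comm]
  apply Finset.sum_congr rfl
  intro q _
  rw [Finset.sum_apply, Finset.mul_sum, Finset.sum_mul, Finset.mul_sum]
  apply Finset.sum_congr rfl
  intro k _
  simp
  ring

lemma wt_pos {n : ℕ} {x : ℕ → ℤ} (hx : ∀ a b, a < b → b ≤ n → x a < x b) {k : ℕ} (hk : k ≤ n) :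
    0 < wt (Finset.range (n + 1)) x k := by
  apply Finset.prod_pos
  intro m hm
  simp at hm
  rw [inv_pos, abs_pos, sub_ne_zero]
  norm_cast
  rcases lt_or_gt_of_ne hm.1 with h | h
  · exact (hx m k h hk).ne'
  · exact (hx k m h (by omega)).ne

/-- normal form of a nonnegative combination -/
lemma comb_normal {n : ℕ} {D : ℤ × ℤ → ℚ} (hD : IsNonnegCombPure n D) :
    ∃ (N : ℕ) (α : Fin N → ℚ) (x : Fin N → ℕ → ℤ), (∀ k, 0 ≤ α k) ∧
      (∀ k a b, a < b → b ≤ n → x k a < x k b) ∧ D = ∑ k, α k • stdD n (x k) ∧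
      mulN n D = ∑ k, α k := by
  obtain ⟨N, a, P, t, h1, h2, h3, h4⟩ := hD
  refine ⟨N, fun k => a k * mulN n (P k), fun k => extSeq n (t k), ?_, ?_, ?_, ?_⟩
  · intro k
    apply mul_nonneg (h1 k)
    have e1 := congrFun (pure_eq (h2 k)) (((0 : ℕ) : ℤ), extSeq n (t k) 0)
    have e2 := h3 k (((0 : ℕ) : ℤ), extSeq n (t k) 0)
    rw [e1, Pi.smul_apply, smul_eq_mul, stdD_self (by omega)] at e2
    exact nonneg_of_mul_nonneg_left e2 (wt_pos (ext_mono (h2 k).strictMono) (by omega))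
  · intro k
    exact ext_mono (h2 k).strictMono
  · rw [h4]
    apply Finset.sum_congr rfl
    intro k _
    conv_lhs => rw [pure_eq (h2 k)]
    rw [smul_smul]
    rfl
  · rw [h4, mulN_sum]
    exact fun k => (h2 k).diagram.finite

/-- if `F` and `G` are nonzero nonnegative linear combinations of pure diagrams
of codimension `p−1` with equal multiplicities and with every maximal shift of `F` strictly
smaller than the corresponding minimal shift of `G`, then `E i j = F i j + G (i−1) j` is a
nonnegative linear combination of pure diagrams of codimension `p`. -/
theorem stmt9 (p : ℕ) (hp : 1 ≤ p) (F G : ℤ × ℤ → ℚ)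
    (hF : IsNonnegCombPure (p - 1) F) (hG : IsNonnegCombPure (p - 1) G)
    (hF0 : F ≠ 0) (hG0 : G ≠ 0)
    (eF eG : ℤ → ℚ)
    (heFfin : (Function.support eF).Finite) (heGfin : (Function.support eG).Finite)
    (heF : SPoly F = (1 - LaurentPolynomial.T 1) ^ (p - 1) * rowPoly eF)
    (heG : SPoly G = (1 - LaurentPolynomial.T 1) ^ (p - 1) * rowPoly eG)
    (hmult : ∑ᶠ i : ℤ, eF i = ∑ᶠ i : ℤ, eG i)
    (hshift : ∀ i : ℤ, 0 ≤ i → i ≤ (p : ℤ) - 1 →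
      ∀ j j' : ℤ, F (i, j) ≠ 0 → G (i, j') ≠ 0 → j < j') :
    IsNonnegCombPure p (fun q => F q + G (q.1 - 1, q.2)) := by
  obtain ⟨n, rfl⟩ : ∃ n, p = n + 1 := ⟨p - 1, by omega⟩
  simp only [Nat.add_sub_cancel] at hF hG heF heG
  have hm : mulN n F = mulN n G := by
    rw [mulN_of heFfin heF, mulN_of heGfin heG, hmult]
  obtain ⟨N, α, x, hα, hx, hFs, hFm⟩ := comb_normal hF
  obtain ⟨M, β, y, hβ, hy, hGs, hGm⟩ := comb_normal hG
  set A := mulN n F with hA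
  have hA0 : A ≠ 0 := by
    intro h0
    rw [h0] at hFm
    have := (Finset.sum_eq_zero_iff_of_nonneg (fun k _ => hα k)).1 hFm.symm
    apply hF0
    rw [hFs]
    apply Finset.sum_eq_zero
    intro k hk
    rw [this k hk, zero_smul]
  have hApos : 0 ≤ A := by
    rw [hFm]; exact Finset.sum_nonneg fun k _ => hα k
  rw [hm] at hFm
  have key : (fun q : ℤ × ℤ => F q + G (q.1 - 1, q.2)) = ∑ k, ∑ l, (α k * β l / A) •
      (fun q : ℤ × ℤ => stdD n (x k) q + stdD n (y l) (q.1 - 1, q.2)) := by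
    funext q
    simp only [Finset.sum_apply, Pi.smul_apply, smul_eq_mul, mul_add, Finset.sum_add_distrib]
    congr 1
    · rw [hFs, Finset.sum_apply]
      apply Finset.sum_congr rfl
      intro k _
      rw [← Finset.sum_mul, ← Finset.sum_div, ← Finset.mul_sum, ← hGm, ← hm]
      simp only [Pi.smul_apply, smul_eq_mul]
      field_simp
    · rw [hGs, Finset.sum_apply, Finset.sum_comm]
      apply Finset.sum_congr rfl
      intro k _
      rw [← Finset.sum_mul, ← Finset.sum_div, ← Finset.sum_mul, ← hFm, ← hm]
      simp only [Pi.smul_apply, smul_eq_mul]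
      field_simp
  rw [key]
  apply comb_sum
  intro k _
  apply comb_sum
  intro l _
  rcases (hα k).eq_or_lt with h0 | hk
  · rw [← h0]; simp only [zero_mul, zero_div, zero_smul]; exact comb_zero _
  rcases (hβ l).eq_or_lt with h0 | hl
  · rw [← h0]; simp only [mul_zero, zero_div, zero_smul]; exact comb_zero _
  apply comb_smul (div_nonneg (mul_nonneg (hα k) (hβ l)) hApos)
  apply comb_pair (hx k) (hy l)
  have pos : ∀ {N : ℕ} {α : Fin N → ℚ} {x : Fin N → ℕ → ℤ} {D : ℤ × ℤ → ℚ} {k : Fin N}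
      (_ : ∀ k, 0 ≤ α k) (_ : ∀ k a b, a < b → b ≤ n → x k a < x k b)
      (_ : D = ∑ k, α k • stdD n (x k)) (_ : 0 < α k) (i : ℕ) (_ : i ≤ n),
      D ((i : ℤ), x k i) ≠ 0 := by
    intro N α x D k hα hx hD hk i hi
    apply ne_of_gt
    rw [hD, Finset.sum_apply]
    apply Finset.sum_pos'
    · intro m _
      exact mul_nonneg (hα m) (stdD_nonneg _ _ _)
    · refine ⟨k, Finset.mem_univ _, ?_⟩
      rw [Pi.smul_apply, smul_eq_mul, stdD_self hi]
      exact mul_pos hk (wt_pos (hx k) hi)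
  intro i hi
  exact hshift i (by omega) (by push_cast; omega) _ _ (pos hα hx hFs hk i hi) (pos hβ hy hGs hl i hi)
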